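/- For homogeneous u, v ∈ V^0, the element u *_{g,n} v − v *_{g,n} u − Res_z Y(u,z)v (1+z)^{wt u − 1} lies in O_{g,n}(V). -/

import Mathlib

/-
Common framework for formalizing
"Twisted representations of vertex operator algebras and associative algebras"
by C. Dong, H. Li, G. Mason.

We formalize a vertex operator algebra `V` over `ℂ` through its modes
`u_m = mode u m` (`m : ℤ`), vacuum `𝟏`, conformal vector `ω` (so that
`L(n) = ω_{n+1}`), a weight grading `wtSpace`, and the Borcherds identity.
An automorphism `g` of finite order `T` gives eigenspaces
`V^r = eigSpace V g T r`.  For `n = l + i/T` the subspace `O_{g,n}(V)` is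
`Ogn V g T l i`, the product `*_{g,n}` is `starMul V g T l`
(it only depends on `l`), and `A_{g,n}(V) = V.carrier ⧸ Ogn V g T l i`.
-/

noncomputable section

open scoped BigOperators

namespace DLM

/-- Generalized binomial coefficient `binom(α, j)` for a rational `α`. -/
def qchoose (α : ℚ) (j : ℕ) : ℚ :=
  (∏ k ∈ Finset.range j, (α - (k : ℚ))) / (Nat.factorial j : ℚ)

/-- A vertex operator algebra over `ℂ`, given by its modes `u_m v = mode u m v`
(the coefficients of `Y(u,z)v`), the vacuum `𝟏`, the conformal vector `ω`
(with `L(n) = ω_{n+1}`), and the integer weight grading. -/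
structure VOA where
  carrier : Type
  [acg : AddCommGroup carrier]
  [mod : Module ℂ carrier]
  mode : carrier →ₗ[ℂ] (ℤ → carrier →ₗ[ℂ] carrier)
  vacuum : carrier
  conformal : carrier
  wtSpace : ℤ → Submodule ℂ carrier
  [decomp : DirectSum.Decomposition wtSpace]
  findim : ∀ k : ℤ, FiniteDimensional ℂ (wtSpace k)
  bounded_below : ∃ N : ℤ, ∀ k : ℤ, k < N → wtSpace k = ⊥
  trunc : ∀ u v : carrier, ∃ N : ℤ, ∀ m : ℤ, N ≤ m → mode u m v = 0
  vacuum_wt : vacuum ∈ wtSpace 0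
  conformal_wt : conformal ∈ wtSpace 2
  vacuum_mode : ∀ (m : ℤ) (v : carrier), mode vacuum m v = if m = -1 then v else 0
  creation₁ : ∀ u : carrier, mode u (-1) vacuum = u
  creation₂ : ∀ (u : carrier) (m : ℤ), 0 ≤ m → mode u m vacuum = 0
  L0_grading : ∀ (k : ℤ), ∀ v ∈ wtSpace k, mode conformal 1 v = (k : ℂ) • v
  mode_grading : ∀ (a b m : ℤ) (u v : carrier), u ∈ wtSpace a → v ∈ wtSpace b →
    mode u m v ∈ wtSpace (a + b - m - 1)
  Lneg1_mode : ∀ (u : carrier) (m : ℤ),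
    mode (mode conformal 0 u) m = (-(m : ℂ)) • (mode u (m - 1))
  borcherds : ∀ (u v w : carrier) (p q s : ℤ),
    ∑ᶠ j : ℕ, ((qchoose (p : ℚ) j : ℚ) : ℂ) • mode (mode u (s + j) v) (p + q - j) w =
    ∑ᶠ j : ℕ, ((-1 : ℂ) ^ j * ((qchoose (s : ℚ) j : ℚ) : ℂ)) •
      (mode u (p + s - j) (mode v (q + j) w)
        - ((-1 : ℂ) ^ s) • mode v (q + s - j) (mode u (p + j) w))

attribute [instance] VOA.acg VOA.mod VOA.decomp

namespace VOA

/-- Projection of `u` onto its weight `k` homogeneous component. -/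
def proj (V : VOA) (k : ℤ) (u : V.carrier) : V.carrier :=
  (((DirectSum.decompose V.wtSpace u) k : V.wtSpace k) : V.carrier)

/-- `res V α β u v = Res_z Y(u,z)v (1+z)^α z^{-β}
  = ∑_{j ≥ 0} binom(α, j) u_{j - β} v`. -/
def res (V : VOA) (α : ℚ) (β : ℤ) (u v : V.carrier) : V.carrier :=
  ∑ᶠ j : ℕ, ((qchoose α j : ℚ) : ℂ) • V.mode u ((j : ℤ) - β) v

end VOA

/-- An automorphism of a vertex operator algebra. -/
structure VOAAut (V : VOA) where
  lin : V.carrier ≃ₗ[ℂ] V.carrier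
  map_vacuum : lin V.vacuum = V.vacuum
  map_conformal : lin V.conformal = V.conformal
  map_mode : ∀ (u : V.carrier) (m : ℤ) (v : V.carrier),
    lin (V.mode u m v) = V.mode (lin u) m (lin v)
  map_wt : ∀ (k : ℤ) (u : V.carrier), u ∈ V.wtSpace k ↔ lin u ∈ V.wtSpace k

/-- The inverse automorphism `g⁻¹`. -/
def VOAAut.symm {V : VOA} (g : VOAAut V) : VOAAut V where
  lin := g.lin.symm
  map_vacuum := g.lin.injective (by rw [LinearEquiv.apply_symm_apply, g.map_vacuum])
  map_conformal := g.lin.injective (by rw [LinearEquiv.apply_symm_apply, g.map_conformal])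
  map_mode := fun u m v => g.lin.injective (by
    rw [LinearEquiv.apply_symm_apply, g.map_mode, LinearEquiv.apply_symm_apply,
      LinearEquiv.apply_symm_apply])
  map_wt := fun k u => by
    have h := (g.map_wt k (g.lin.symm u)).symm
    rwa [LinearEquiv.apply_symm_apply] at h

/-- The eigenspace `V^r = {v ∈ V | g v = e^{-2πir/T} v}`. -/
def eigSpace (V : VOA) (g : VOAAut V) (T r : ℕ) : Submodule ℂ V.carrier where
  carrier := {v | g.lin v =
    Complex.exp (-(2 * (Real.pi : ℂ) * Complex.I * (r : ℂ)) / (T : ℂ)) • v}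
  add_mem' := fun {a b} ha hb => by
    simp only [Set.mem_setOf_eq] at *
    rw [map_add, ha, hb, smul_add]
  zero_mem' := by simp
  smul_mem' := fun c a ha => by
    simp only [Set.mem_setOf_eq] at *
    rw [map_smul, ha, smul_comm]

/-- `δ_i(r)`: equals `1` if `r ≤ i` or `r = T`, and `0` otherwise. -/
def deltaI (T i r : ℕ) : ℕ := if r ≤ i ∨ r = T then 1 else 0

/-- `O_{g,n}(V)` for `n = l + i/T`: the span of all `L(-1)u + L(0)u` and all
`u ∘_{g,n} v = Res_z Y(u,z)v (1+z)^{wt u - 1 + δ_i(r) + l + r/T}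
 / z^{2l + δ_i(r) + δ_i(T-r)}` for homogeneous `u ∈ V^r`. -/
def Ogn (V : VOA) (g : VOAAut V) (T l i : ℕ) : Submodule ℂ V.carrier :=
  Submodule.span ℂ
    ({x | ∃ u : V.carrier, x = V.mode V.conformal 0 u + V.mode V.conformal 1 u} ∪
     {x | ∃ r : ℕ, r < T ∧ ∃ (k : ℤ) (u v : V.carrier),
        u ∈ V.wtSpace k ∧ u ∈ eigSpace V g T r ∧
        x = V.res ((k : ℚ) - 1 + (deltaI T i r : ℚ) + (l : ℚ) + (r : ℚ) / (T : ℚ))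
              (2 * (l : ℤ) + (deltaI T i r : ℤ) + (deltaI T i (T - r) : ℤ)) u v})

/-- The product `u *_{g,n} v` for `u` homogeneous of weight `k` in `V^0`:
`∑_{m=0}^{l} (-1)^m binom(m+l, l) Res_z Y(u,z) (1+z)^{wt u + l} z^{-(l+m+1)} v`. -/
def starFor (V : VOA) (l : ℕ) (k : ℤ) (u v : V.carrier) : V.carrier :=
  ∑ m ∈ Finset.range (l + 1),
    ((-1 : ℂ) ^ m * (Nat.choose (m + l) l : ℂ)) •
      V.res ((k : ℚ) + (l : ℚ)) ((l : ℤ) + (m : ℤ) + 1) u v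

/-- Projection onto the eigenspace `V^r` of the finite order automorphism `g`. -/
def eigProj (V : VOA) (g : VOAAut V) (T r : ℕ) (v : V.carrier) : V.carrier :=
  (T : ℂ)⁻¹ • ∑ t ∈ Finset.range T,
    Complex.exp ((2 * (Real.pi : ℂ) * Complex.I * (r : ℂ) * (t : ℂ)) / (T : ℂ)) •
      ((g.lin ^ t) v)

/-- The bilinear extension of `*_{g,n}` to all of `V` (it vanishes when the first
argument is homogeneous in `V^r`, `r ≠ 0`, and only depends on `l`). -/
def starMul (V : VOA) (g : VOAAut V) (T l : ℕ) (u v : V.carrier) : V.carrier :=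
  ∑ᶠ k : ℤ, starFor V l k (eigProj V g T 0 (V.proj k u)) v

/-- The subspace `O_{1,l}(V^0)` of the untwisted theory of the fixed point
subalgebra `V^0` (all `δ` terms equal `1`), viewed inside `V`. -/
def OgnV0 (V : VOA) (g : VOAAut V) (T l : ℕ) : Submodule ℂ V.carrier :=
  Submodule.span ℂ
    ({x | ∃ u ∈ eigSpace V g T 0, x = V.mode V.conformal 0 u + V.mode V.conformal 1 u} ∪
     {x | ∃ (k : ℤ) (u v : V.carrier),
        u ∈ V.wtSpace k ∧ u ∈ eigSpace V g T 0 ∧ v ∈ eigSpace V g T 0 ∧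
        x = V.res ((k : ℚ) + (l : ℚ)) (2 * (l : ℤ) + 2) u v})

/-- `e^{L(1)} v` (where `L(1) = ω_2`). -/
def expL1 (V : VOA) (v : V.carrier) : V.carrier :=
  ∑ᶠ j : ℕ, ((Nat.factorial j : ℂ))⁻¹ • ((fun w => V.mode V.conformal 2 w)^[j] v)

/-- The map `φ : v ↦ e^{L(1)} (-1)^{L(0)} v`. -/
def phiMap (V : VOA) (v : V.carrier) : V.carrier :=
  ∑ᶠ k : ℤ, ((-1 : ℂ) ^ k) • expL1 V (V.proj k v)

/-- `l`-component of `n - 1/T` when `n = l + i/T`. -/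
def predL (l i : ℕ) : ℕ := if i = 0 then l - 1 else l

/-- `i`-component of `n - 1/T` when `n = l + i/T`. -/
def predI (T i : ℕ) : ℕ := if i = 0 then T - 1 else i - 1

/-- The rational number `n = l + i/T`. -/
def nval (T l i : ℕ) : ℚ := (l : ℚ) + (i : ℚ) / (T : ℚ)

/-- A weak `g`-twisted `V`-module: modes `v_m = act v m` for `m ∈ (1/T)ℤ ⊆ ℚ`,
satisfying the truncation, vacuum and twisted Borcherds (Jacobi) identities. -/
structure TwModule (V : VOA) (g : VOAAut V) (T : ℕ) where
  carrier : Type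
  [acg : AddCommGroup carrier]
  [mod : Module ℂ carrier]
  act : V.carrier →ₗ[ℂ] (ℚ → carrier →ₗ[ℂ] carrier)
  act_eig : ∀ r : ℕ, r < T → ∀ u ∈ eigSpace V g T r, ∀ m : ℚ,
    (¬ ∃ z : ℤ, m = (z : ℚ) + (r : ℚ) / (T : ℚ)) → act u m = 0
  act_trunc : ∀ (u : V.carrier) (x : carrier), ∃ N : ℤ, ∀ m : ℚ, (N : ℚ) ≤ m → act u m x = 0
  act_vacuum : ∀ (m : ℚ) (x : carrier), act V.vacuum m x = if m = -1 then x else 0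
  jacobi : ∀ r s : ℕ, r < T → s < T → ∀ u ∈ eigSpace V g T r, ∀ v ∈ eigSpace V g T s,
    ∀ (a b c : ℤ) (x : carrier),
    ∑ᶠ j : ℕ, ((qchoose ((r : ℚ) / (T : ℚ) + (a : ℚ)) j : ℚ) : ℂ) •
        act (V.mode u (c + j) v) ((r : ℚ) / (T : ℚ) + (s : ℚ) / (T : ℚ) + a + b - j) x =
    ∑ᶠ j : ℕ, ((-1 : ℂ) ^ j * ((qchoose (c : ℚ) j : ℚ) : ℂ)) •
        (act u ((r : ℚ) / (T : ℚ) + a + c - j) (act v ((s : ℚ) / (T : ℚ) + b + j) x)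
          - ((-1 : ℂ) ^ c) •
            act v ((s : ℚ) / (T : ℚ) + b + c - j) (act u ((r : ℚ) / (T : ℚ) + a + j) x))

attribute [instance] TwModule.acg TwModule.mod

namespace TwModule

variable {V : VOA} {g : VOAAut V} {T : ℕ}

/-- The operator `o_p(a) = a_{wt a - 1 - p}`, extended linearly from homogeneous `a`. -/
def oactL (M : TwModule V g T) (p : ℚ) (a : V.carrier) : M.carrier →ₗ[ℂ] M.carrier :=
  ∑ᶠ k : ℤ, M.act (V.proj k a) ((k : ℚ) - 1 - p)

/-- `Ω_n(M) = {x ∈ M | V[g]_{-k} x = 0 for all k > n}`, i.e. `v_m x = 0` whenever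
`v` is homogeneous of weight `d` and `d - 1 - m < -n`. -/
def Omega (M : TwModule V g T) (n : ℚ) : Submodule ℂ M.carrier where
  carrier := {x | ∀ (k : ℤ) (u : V.carrier), u ∈ V.wtSpace k → ∀ m : ℚ,
    (k : ℚ) - 1 + n < m → M.act u m x = 0}
  add_mem' := fun {a b} ha hb => by
    intro k u hu m hm
    rw [map_add, ha k u hu m hm, hb k u hu m hm, add_zero]
  zero_mem' := fun k u hu m hm => map_zero _
  smul_mem' := fun c a ha => by
    intro k u hu m hm
    rw [map_smul, ha k u hu m hm, smul_zero]

theorem mem_Omega {M : TwModule V g T} {n : ℚ} {x : M.carrier} :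
    x ∈ M.Omega n ↔ ∀ (k : ℤ) (u : V.carrier), u ∈ V.wtSpace k → ∀ m : ℚ,
      (k : ℚ) - 1 + n < m → M.act u m x = 0 := Iff.rfl

/-- `Ω_{n-1/T}(M)`, viewed as a submodule of `Ω_n(M)`. -/
def OmegaSub (M : TwModule V g T) (n : ℚ) : Submodule ℂ (M.Omega n) :=
  (M.Omega (n - 1 / (T : ℚ))).comap (M.Omega n).subtype

/-- The quotient `Ω_n(M)/Ω_{n-1/T}(M)`. -/
abbrev OmegaQ (M : TwModule V g T) (n : ℚ) :=
  (M.Omega n) ⧸ (M.OmegaSub n)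

open Classical in
/-- The action of `o(a)` on `Ω_n(M)` (it does preserve `Ω_n(M)`). -/
def oactOmega (M : TwModule V g T) (n : ℚ) (a : V.carrier) :
    M.Omega n →ₗ[ℂ] M.Omega n :=
  if h : ∀ x ∈ M.Omega n, M.oactL 0 a x ∈ M.Omega n then (M.oactL 0 a).restrict h else 0

open Classical in
/-- The induced action of `o(a)` on `Ω_n(M)/Ω_{n-1/T}(M)`. -/
def oactQ (M : TwModule V g T) (n : ℚ) (a : V.carrier) :
    M.OmegaQ n →ₗ[ℂ] M.OmegaQ n :=
  if h : M.OmegaSub n ≤ (M.OmegaSub n).comap (M.oactOmega n a) then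
    Submodule.mapQ _ _ (M.oactOmega n a) h
  else 0

end TwModule

/-- A morphism of weak `g`-twisted `V`-modules. -/
structure TwHom {V : VOA} {g : VOAAut V} {T : ℕ} (M N : TwModule V g T) where
  toLin : M.carrier →ₗ[ℂ] N.carrier
  comm : ∀ (u : V.carrier) (m : ℚ) (x : M.carrier), toLin (M.act u m x) = N.act u m (toLin x)

namespace TwHom

variable {V : VOA} {g : VOAAut V} {T : ℕ}

def id (M : TwModule V g T) : TwHom M M := ⟨LinearMap.id, fun _ _ _ => rfl⟩

def comp {M N P : TwModule V g T} (f' : TwHom N P) (f : TwHom M N) : TwHom M P :=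
  ⟨f'.toLin.comp f.toLin, fun u m x => by
    simp only [LinearMap.comp_apply, f.comm, f'.comm]⟩

theorem mapsOmega {M N : TwModule V g T} (f : TwHom M N) (n : ℚ) :
    ∀ x ∈ M.Omega n, f.toLin x ∈ N.Omega n := fun x hx k u hu m hm => by
  rw [← f.comm, hx k u hu m hm, map_zero]

/-- The restriction of a morphism to `Ω_n`. -/
def omegaMap {M N : TwModule V g T} (f : TwHom M N) (n : ℚ) :
    M.Omega n →ₗ[ℂ] N.Omega n :=
  f.toLin.restrict (f.mapsOmega n)

/-- The induced map `Ω_n(M)/Ω_{n-1/T}(M) → Ω_n(N)/Ω_{n-1/T}(N)`. -/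
def omegaQMap {M N : TwModule V g T} (f : TwHom M N) (n : ℚ) :
    M.OmegaQ n →ₗ[ℂ] N.OmegaQ n :=
  Submodule.mapQ _ _ (f.omegaMap n) (fun x hx => f.mapsOmega (n - 1 / (T : ℚ)) x.1 hx)

end TwHom

/-- An admissible (`(1/T)ℤ≥0`-graded) `g`-twisted `V`-module. -/
structure AdmTwModule (V : VOA) (g : VOAAut V) (T : ℕ) extends TwModule V g T where
  grade : ℚ → Submodule ℂ carrier
  [gdecomp : DirectSum.Decomposition grade]
  grade_support : ∀ q : ℚ, (q < 0 ∨ ¬ ∃ z : ℤ, q = (z : ℚ) / (T : ℚ)) → grade q = ⊥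
  grade_act : ∀ (k : ℤ) (u : V.carrier), u ∈ V.wtSpace k → ∀ (m p : ℚ), ∀ x ∈ grade p,
    act u m x ∈ grade (p + (k : ℚ) - m - 1)

attribute [instance] AdmTwModule.gdecomp

namespace AdmTwModule

variable {V : VOA} {g : VOAAut V} {T : ℕ}

/-- A submodule invariant under all twisted vertex operators. -/
def InvSub (M : AdmTwModule V g T) (W : Submodule ℂ M.carrier) : Prop :=
  ∀ (u : V.carrier) (m : ℚ), ∀ x ∈ W, M.act u m x ∈ W

/-- A graded submodule (closed under homogeneous components). -/
def GradedSub (M : AdmTwModule V g T) (W : Submodule ℂ M.carrier) : Prop :=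
  ∀ x ∈ W, ∀ q : ℚ, (((DirectSum.decompose M.grade x) q : M.grade q) : M.carrier) ∈ W

/-- A simple (irreducible) admissible module: nonzero, with no proper nonzero
graded submodule. -/
def IsSimple (M : AdmTwModule V g T) : Prop :=
  (∃ x : M.carrier, x ≠ 0) ∧
  ∀ W : Submodule ℂ M.carrier, M.InvSub W → M.GradedSub W → W = ⊥ ∨ W = ⊤

/-- `W` is a simple (irreducible) admissible submodule of `M`. -/
def SubSimple (M : AdmTwModule V g T) (W : Submodule ℂ M.carrier) : Prop :=
  W ≠ ⊥ ∧ ∀ W' : Submodule ℂ M.carrier, W' ≤ W → M.InvSub W' → M.GradedSub W' →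
    W' = ⊥ ∨ W' = W

/-- `M` is a direct sum of irreducible admissible submodules. -/
def CompletelyReducible (M : AdmTwModule V g T) : Prop :=
  ∃ (κ : Type) (S : κ → Submodule ℂ M.carrier),
    (∀ j, M.InvSub (S j) ∧ M.GradedSub (S j) ∧ M.SubSimple (S j)) ∧
    iSupIndep S ∧ (⨆ j, S j) = ⊤

end AdmTwModule

/-- `V` is `g`-rational: every admissible `g`-twisted module is a direct sum of
irreducible admissible `g`-twisted modules. -/
def GRational (V : VOA) (g : VOAAut V) (T : ℕ) : Prop :=
  ∀ M : AdmTwModule V g T, M.CompletelyReducible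

/-- An ordinary `g`-twisted `V`-module: graded by `L(0)`-eigenvalues with
finite dimensional pieces and spectrum bounded below in each congruence class
mod `(1/T)ℤ`. -/
structure OrdTwModule (V : VOA) (g : VOAAut V) (T : ℕ) extends TwModule V g T where
  egrade : ℂ → Submodule ℂ carrier
  [edecomp : DirectSum.Decomposition egrade]
  egrade_L0 : ∀ lam : ℂ, ∀ x ∈ egrade lam, act V.conformal 1 x = lam • x
  egrade_findim : ∀ lam : ℂ, FiniteDimensional ℂ (egrade lam)
  egrade_bounded : ∀ lam : ℂ, ∃ N : ℤ, ∀ m : ℤ, m ≤ N →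
    egrade (lam + (m : ℂ) / (T : ℂ)) = ⊥

attribute [instance] OrdTwModule.edecomp

/-- A module over the associative algebra `A_{g,n}(V)` (with `n = l + i/T`),
given as a representation of `V` that kills `O_{g,n}(V)`, takes the vacuum to
the identity, and turns `*_{g,n}` into composition. -/
structure AMod (V : VOA) (g : VOAAut V) (T l i : ℕ) where
  carrier : Type
  [acg : AddCommGroup carrier]
  [mod : Module ℂ carrier]
  rho : V.carrier →ₗ[ℂ] (carrier →ₗ[ℂ] carrier)
  rho_O : ∀ a ∈ Ogn V g T l i, rho a = 0
  rho_one : rho V.vacuum = LinearMap.id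
  rho_star : ∀ a b : V.carrier, rho (starMul V g T l a b) = (rho a).comp (rho b)

attribute [instance] AMod.acg AMod.mod

namespace AMod

variable {V : VOA} {g : VOAAut V} {T l i : ℕ}

/-- `U` does not factor through `A_{g,n-1/T}(V)`. -/
def NotFactor (U : AMod V g T l i) : Prop :=
  ∃ a ∈ Ogn V g T (predL l i) (predI T i), U.rho a ≠ 0

/-- An invariant subspace. -/
def SubInv (U : AMod V g T l i) (W : Submodule ℂ U.carrier) : Prop :=
  ∀ a : V.carrier, ∀ x ∈ W, U.rho a x ∈ W

/-- `W` is a simple `A_{g,n}(V)`-submodule of `U`. -/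
def SubSimple (U : AMod V g T l i) (W : Submodule ℂ U.carrier) : Prop :=
  W ≠ ⊥ ∧ ∀ W' : Submodule ℂ U.carrier, W' ≤ W → U.SubInv W' → W' = ⊥ ∨ W' = W

/-- `U` is a simple `A_{g,n}(V)`-module. -/
def IsSimple (U : AMod V g T l i) : Prop :=
  (∃ x : U.carrier, x ≠ 0) ∧ ∀ W : Submodule ℂ U.carrier, U.SubInv W → W = ⊥ ∨ W = ⊤

/-- `U` is a direct sum of simple `A_{g,n}(V)`-modules. -/
def CompletelyReducible (U : AMod V g T l i) : Prop :=
  ∃ (κ : Type) (S : κ → Submodule ℂ U.carrier),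
    (∀ j, U.SubInv (S j) ∧ U.SubSimple (S j)) ∧ iSupIndep S ∧ (⨆ j, S j) = ⊤

/-- All irreducible components of `U` do not factor through `A_{g,n-1/T}(V)`. -/
def GoodComponents (U : AMod V g T l i) : Prop :=
  ∀ W : Submodule ℂ U.carrier, U.SubInv W → U.SubSimple W →
    ∃ a ∈ Ogn V g T (predL l i) (predI T i), ∃ x ∈ W, U.rho a x ≠ 0

end AMod

/-- A morphism of `A_{g,n}(V)`-modules. -/
structure AModHom {V : VOA} {g : VOAAut V} {T l i : ℕ} (U U' : AMod V g T l i) where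
  toLin : U.carrier →ₗ[ℂ] U'.carrier
  comm : ∀ (a : V.carrier) (x : U.carrier), toLin (U.rho a x) = U'.rho a (toLin x)

namespace AModHom

variable {V : VOA} {g : VOAAut V} {T l i : ℕ}

def id (U : AMod V g T l i) : AModHom U U := ⟨LinearMap.id, fun _ _ => rfl⟩

def comp {U U' U'' : AMod V g T l i} (f' : AModHom U' U'') (f : AModHom U U') :
    AModHom U U'' :=
  ⟨f'.toLin.comp f.toLin, fun a x => by simp only [LinearMap.comp_apply, f.comm, f'.comm]⟩

end AModHom

end DLM

namespace DLM

theorem qchoose_zero (α : ℚ) : qchoose α 0 = 1 := by simp [qchoose]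

theorem qchoose_succ (α : ℚ) (j : ℕ) :
    qchoose α (j + 1) = α / (j + 1) * qchoose (α - 1) j := by
  have hj : ((j : ℚ) + 1) ≠ 0 := by positivity
  have hf : (Nat.factorial j : ℚ) ≠ 0 := by positivity
  have h : ∏ k ∈ Finset.range j, (α - ((k + 1 : ℕ) : ℚ))
      = ∏ k ∈ Finset.range j, (α - 1 - (k : ℚ)) :=
    Finset.prod_congr rfl fun k _ => by push_cast; ring
  rw [qchoose, qchoose, Finset.prod_range_succ', h, Nat.factorial_succ]
  push_cast
  field_simp
  ring

theorem qchoose_eq_choose (α : ℚ) (j : ℕ) : qchoose α j = Ring.choose α j := by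
  rw [qchoose, Ring.choose_eq_smul, ← Polynomial.aeval_eq_smeval, Polynomial.aeval_def,
    ← Polynomial.eval_map, descPochhammer_map, descPochhammer_eval_eq_prod_range, smul_eq_mul,
    div_eq_inv_mul]

/-- The Chu–Vandermonde identity. -/
theorem sum_qchoose_mul_qchoose (α β : ℚ) (p : ℕ) :
    ∑ i ∈ Finset.range (p + 1), qchoose α i * qchoose β (p - i) = qchoose (α + β) p := by
  simp only [qchoose_eq_choose]
  rw [Ring.add_choose_eq p (Commute.all α β), Finset.Nat.sum_antidiagonal_eq_sum_range_succ_mk]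

/-- Pascal's rule. -/
theorem qchoose_add_one (α : ℚ) (j : ℕ) :
    qchoose (α + 1) (j + 1) = qchoose α (j + 1) + qchoose α j := by
  simp only [qchoose_eq_choose, Ring.choose_succ_succ]
  ring

theorem neg_one_pow_mul_qchoose (α : ℚ) (p : ℕ) :
    (-1) ^ p * qchoose (p - 1 - α) p = qchoose α p := by
  have h : (-1 : ℚ) ^ p = ∏ _k ∈ Finset.range p, (-1 : ℚ) := by simp
  rw [qchoose, qchoose, ← mul_div_assoc, ← Finset.prod_range_reflect, h,
    ← Finset.prod_mul_distrib]
  congr 1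
  refine Finset.prod_congr rfl fun k hk => ?_
  rw [Finset.mem_range] at hk
  rw [Nat.cast_sub (by omega), Nat.cast_sub (by omega)]
  push_cast
  ring

theorem qchoose_neg_one (j : ℕ) : qchoose (-1) j = (-1) ^ j := by
  induction j with
  | zero => exact qchoose_zero _
  | succ j ih =>
    have h := qchoose_add_one (-1) j
    have h0 : qchoose (-1 + 1) (j + 1) = 0 := by rw [qchoose_succ]; simp
    rw [h0, ih] at h
    rw [pow_succ]
    linarith

theorem finsum_eq_sum_range {M : Type*} [AddCommMonoid M] (f : ℕ → M) (N : ℕ)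
    (h : ∀ j, N ≤ j → f j = 0) : ∑ᶠ j, f j = ∑ j ∈ Finset.range N, f j :=
  finsum_eq_sum_of_support_subset _ fun j hj => by
    by_contra hn
    exact hj (h j (by simpa using hn))

section Identity

variable {R : Type*} [CommRing R] (x y : R)

/-- `∑_{m ≤ k} binom(m+j, j) y^{j+1} x^m (x+y)^{k-m}`, defined by its recursion in `k`. -/
def negBinomSum (j : ℕ) : ℕ → R
  | 0 => y ^ (j + 1)
  | k + 1 => (x + y) * negBinomSum j k + ((k + 1 + j).choose j : R) * (y ^ (j + 1) * x ^ (k + 1))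

theorem negBinomSum_eq (j k : ℕ) : negBinomSum x y j k =
    ∑ m ∈ Finset.range (k + 1), ((m + j).choose j : R) * (y ^ (j + 1) * x ^ m) *
      (x + y) ^ (k - m) := by
  induction k with
  | zero => simp [negBinomSum]
  | succ k ih =>
    rw [negBinomSum, ih, Finset.sum_range_succ _ (k + 1), Finset.mul_sum]
    congr 1
    · refine Finset.sum_congr rfl fun m hm => ?_
      rw [Finset.mem_range] at hm
      rw [show k + 1 - m = k - m + 1 by omega, pow_succ]
      ring
    · simp

theorem negBinomSum_succ_left (j k : ℕ) : negBinomSum x y (j + 1) k =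
    (x + y) * negBinomSum x y j k
      - ((j + 1 + k).choose k : R) * (x ^ (k + 1) * y ^ (j + 1)) := by
  induction k with
  | zero => simp only [negBinomSum, add_zero, Nat.choose_zero_right]; push_cast; ring
  | succ k ih =>
    have h1 : (k + 1 + (j + 1)).choose (j + 1) = (k + 1 + j).choose j + (j + 1 + k).choose k := by
      rw [show k + 1 + (j + 1) = (k + 1 + j) + 1 by ring, Nat.choose_succ_succ,
        show j + 1 + k = k + (j + 1) by ring, Nat.choose_symm_add,
        show k + 1 + j = k + (j + 1) by ring]
    have h2 : (j + 1 + (k + 1)).choose (k + 1) = (k + 1 + (j + 1)).choose (j + 1) := by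
      rw [add_comm (k + 1) (j + 1), Nat.choose_symm_add]
    rw [negBinomSum, negBinomSum, ih, h2, h1]
    push_cast
    ring

theorem negBinomSum_add_swap (j k : ℕ) :
    negBinomSum x y j k + negBinomSum y x k j = (x + y) ^ (j + k + 1) := by
  induction j with
  | zero =>
    induction k with
    | zero => simp [negBinomSum, add_comm]
    | succ k ih =>
      simp only [negBinomSum] at ih ⊢
      rw [show 0 + (k + 1) + 1 = 0 + k + 1 + 1 by ring, pow_succ (x + y), ← ih]
      simp
      ring
  | succ j ih =>
    rw [negBinomSum_succ_left, negBinomSum,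
      show j + 1 + k + 1 = j + k + 1 + 1 by ring, pow_succ (x + y), ← ih]
    ring

end Identity

namespace VOA

variable (V : VOA)

theorem res_eq_sum {N : ℤ} {u v : V.carrier} (hN : ∀ m, N ≤ m → V.mode u m v = 0)
    (α : ℚ) (β : ℤ) (M : ℕ) (hM : N + β ≤ M) :
    V.res α β u v = ∑ j ∈ Finset.range M, (qchoose α j : ℂ) • V.mode u (j - β) v :=
  finsum_eq_sum_range _ _ fun j hj => by rw [hN _ (by omega), smul_zero]

theorem res_add_one (α : ℚ) (β : ℤ) (u v : V.carrier) :
    V.res (α + 1) β u v = V.res α β u v + V.res α (β - 1) u v := by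
  obtain ⟨N, hN⟩ := V.trunc u v
  have hM : N + β ≤ ((N + β).toNat : ℤ) := Int.self_le_toNat _
  rw [V.res_eq_sum hN _ β ((N + β).toNat + 1) (by omega),
    V.res_eq_sum hN _ β ((N + β).toNat + 1) (by omega),
    V.res_eq_sum hN _ (β - 1) (N + β).toNat (by omega),
    Finset.sum_range_succ', Finset.sum_range_succ', qchoose_zero, qchoose_zero, add_right_comm,
    ← Finset.sum_add_distrib]
  congr 1
  refine Finset.sum_congr rfl fun j _ => ?_
  rw [qchoose_add_one, Rat.cast_add, add_smul]
  congr 3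
  push_cast
  ring_nf

/-- The linear map sending a polynomial `p(z)` to `Res_z Y(u,z)v (1+z)^α z^{-β} p(z)`. -/
def resPoly (α : ℚ) (β : ℤ) (u v : V.carrier) : Polynomial ℂ →ₗ[ℂ] V.carrier :=
  (Polynomial.basisMonomials ℂ).constr ℂ fun k => V.res α (β - k) u v

theorem resPoly_X_pow (α : ℚ) (β : ℤ) (u v : V.carrier) (k : ℕ) :
    V.resPoly α β u v (Polynomial.X ^ k) = V.res α (β - k) u v := by
  have h := (Polynomial.basisMonomials ℂ).constr_basis ℂ (fun k => V.res α (β - k) u v) k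
  rw [Polynomial.coe_basisMonomials] at h
  rwa [← Polynomial.monomial_one_right_eq_X_pow]

theorem resPoly_one_add_X_pow_mul (α : ℚ) (β : ℤ) (u v : V.carrier) (e k : ℕ) :
    V.resPoly α β u v ((1 + Polynomial.X) ^ e * Polynomial.X ^ k)
      = V.res (α + e) (β - k) u v := by
  induction e generalizing k with
  | zero => simp [resPoly_X_pow]
  | succ e ih =>
    have h : ((1 + Polynomial.X) ^ (e + 1) * Polynomial.X ^ k : Polynomial ℂ) =
        (1 + Polynomial.X) ^ e * Polynomial.X ^ k
          + (1 + Polynomial.X) ^ e * Polynomial.X ^ (k + 1) := by ring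
    rw [h, map_add, ih, ih, Nat.cast_succ, Nat.cast_succ, ← add_assoc, res_add_one, sub_sub]

/-- The residue form of the identity
`∑_m binom(m+l, l) ((-1)^m (1+z)^{l+1} - (-1)^l (1+z)^m) z^{-(l+m+1)} = 1`. -/
theorem sum_res_sub_res (l : ℕ) (α : ℚ) (u v : V.carrier) :
    ∑ m ∈ Finset.range (l + 1), (((-1 : ℂ) ^ m * (Nat.choose (m + l) l : ℂ)) •
        V.res (α + 1 + l) (l + m + 1) u v
      - ((-1 : ℂ) ^ l * (Nat.choose (m + l) l : ℂ)) • V.res (α + m) (l + m + 1) u v)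
      = V.res α 0 u v := by
  have h := negBinomSum_add_swap (-1 : Polynomial ℂ) (1 + Polynomial.X) l l
  rw [negBinomSum_eq, negBinomSum_eq, ← Finset.sum_add_distrib] at h
  replace h := congrArg (V.resPoly α (2 * l + 1) u v) h
  rw [map_sum, show (-1 : Polynomial ℂ) + (1 + Polynomial.X) = Polynomial.X by ring,
    resPoly_X_pow] at h
  convert h using 1
  · refine Finset.sum_congr rfl fun m hm => ?_
    rw [Finset.mem_range] at hm
    have e : (((m + l).choose l : Polynomial ℂ) * ((1 + Polynomial.X) ^ (l + 1) * (-1) ^ m) *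
          Polynomial.X ^ (l - m) + ((m + l).choose l : Polynomial ℂ) *
          ((-1) ^ (l + 1) * (1 + Polynomial.X) ^ m) * (1 + Polynomial.X + -1) ^ (l - m)) =
        ((-1 : ℂ) ^ m * (Nat.choose (m + l) l : ℂ)) •
          ((1 + Polynomial.X) ^ (l + 1) * Polynomial.X ^ (l - m)) -
        ((-1 : ℂ) ^ l * (Nat.choose (m + l) l : ℂ)) •
          ((1 + Polynomial.X) ^ m * Polynomial.X ^ (l - m)) := by
      rw [show (1 : Polynomial ℂ) + Polynomial.X + -1 = Polynomial.X by ring]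
      simp only [Polynomial.smul_eq_C_mul, map_mul, map_pow, map_neg, map_one, map_natCast]
      ring
    rw [e, map_sub, map_smul, map_smul, resPoly_one_add_X_pow_mul, resPoly_one_add_X_pow_mul]
    push_cast [Nat.cast_sub (show m ≤ l by omega)]
    congr 3 <;> ring
  · congr 1
    push_cast
    ring

end VOA

section Quotient

variable (V : VOA) (O : Submodule ℂ V.carrier)
  (hO : ∀ x, V.mode V.conformal 0 x + V.mode V.conformal 1 x ∈ O)

include hO

/-- `L(-1)^j x / j! ≡ binom(-wt x, j) x` modulo the image of `L(-1) + L(0)`. -/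
theorem mkQ_mode_vacuum (j : ℕ) (k : ℤ) (x : V.carrier) (hx : x ∈ V.wtSpace k) :
    O.mkQ (V.mode x (-1 - j) V.vacuum) = (qchoose (-k) j : ℂ) • O.mkQ x := by
  induction j generalizing k x with
  | zero => simp [V.creation₁, qchoose_zero]
  | succ j ih =>
    have hL : V.mode V.conformal 0 x ∈ V.wtSpace (k + 1) := by
      have := V.mode_grading 2 k 0 _ _ V.conformal_wt hx
      rwa [show (2 : ℤ) + k - 0 - 1 = k + 1 by ring] at this
    have h1 : O.mkQ (V.mode V.conformal 0 x) = -(k : ℂ) • O.mkQ x := by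
      have h := (Submodule.Quotient.mk_eq_zero O).2 (hO x)
      rw [← Submodule.mkQ_apply, map_add, V.L0_grading k x hx, map_smul] at h
      rw [neg_smul]
      exact eq_neg_of_add_eq_zero_left h
    have h2 := ih (k + 1) _ hL
    rw [V.Lneg1_mode, h1, LinearMap.smul_apply, map_smul] at h2
    have hj : ((j : ℂ) + 1) ≠ 0 := by exact_mod_cast Nat.succ_ne_zero j
    have h3 : -(((-1 - (j : ℤ) : ℤ)) : ℂ) = (j : ℂ) + 1 := by push_cast; ring
    rw [h3, show (-1 - (j : ℤ) - 1) = -1 - ((j + 1 : ℕ) : ℤ) by push_cast; ring] at h2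
    rw [← inv_smul_smul₀ hj (O.mkQ _), h2, smul_smul, smul_smul, qchoose_succ]
    congr 1
    push_cast
    rw [show (-(k : ℚ) - 1) = -(k + 1) by ring]
    field_simp

/-- Skew symmetry modulo the image of `L(-1) + L(0)`. -/
theorem mkQ_mode_swap {a b : ℤ} {u v : V.carrier} (hu : u ∈ V.wtSpace a) (hv : v ∈ V.wtSpace b)
    {N : ℤ} (hN : ∀ m, N ≤ m → V.mode u m v = 0) (n : ℤ) (M : ℕ) (hM : N ≤ n + M) :
    O.mkQ (V.mode v n u) = ∑ j ∈ Finset.range M,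
      ((-1 : ℂ) ^ (n + j + 1) * (qchoose ((n + j + 1 - a - b : ℤ) : ℚ) j : ℂ)) •
        O.mkQ (V.mode u (n + j) v) := by
  have h := V.borcherds u v V.vacuum (-1) 0 n
  rw [finsum_eq_sum_range _ M fun j hj => by
      rw [hN _ (by omega), map_zero, Pi.zero_apply, LinearMap.zero_apply, smul_zero],
    finsum_eq_sum_range _ 1 fun j hj => by
      rw [V.creation₂ v _ (by omega), V.creation₂ u _ (by omega)]; simp] at h
  have hs : ((-1 : ℂ) ^ n) * (-1 : ℂ) ^ n = 1 := by
    rw [← mul_zpow]; simp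
  have h' : V.mode v n u = (-(-1 : ℂ) ^ n) • ∑ j ∈ Finset.range M,
      (((qchoose ((-1 : ℤ) : ℚ) j : ℚ) : ℂ)) •
        V.mode (V.mode u (n + j) v) (-1 + 0 - j) V.vacuum := by
    rw [h]
    simp [V.creation₁, V.creation₂, qchoose_zero, smul_smul, hs]
  rw [h', map_smul, map_sum, Finset.smul_sum]
  refine Finset.sum_congr rfl fun j _ => ?_
  rw [map_smul, add_zero, mkQ_mode_vacuum V O hO j _ _ (V.mode_grading a b _ u v hu hv),
    smul_smul, smul_smul]
  congr 1
  have : (-1 : ℂ) ≠ 0 := by norm_num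
  rw [Int.cast_neg, Int.cast_one, qchoose_neg_one, zpow_add₀ this, zpow_add₀ this, zpow_natCast]
  push_cast
  ring_nf

/-- `Res_z Y(v,z)u (1+z)^α z^{-β} ≡ Res_w Y(u,w)v (1+w)^γ (-1)^{β+1} w^{-β}` with
`γ = wt u + wt v - α + β - 2`: the substitution `z = -w/(1+w)`. -/
theorem mkQ_res_swap {a b : ℤ} {u v : V.carrier} (hu : u ∈ V.wtSpace a) (hv : v ∈ V.wtSpace b)
    (α : ℚ) (β : ℤ) :
    O.mkQ (V.res α β v u) =
      (-1 : ℂ) ^ (β + 1) • O.mkQ (V.res (a + b - α + β - 2) β u v) := by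
  obtain ⟨N, hN⟩ := V.trunc u v
  obtain ⟨N', hN'⟩ := V.trunc v u
  obtain ⟨M, hM⟩ : ∃ M : ℕ, N + β ≤ M ∧ N' + β ≤ M :=
    ⟨max (N + β).toNat (N' + β).toNat, by omega⟩
  rw [V.res_eq_sum hN _ _ M hM.1, V.res_eq_sum hN' _ _ M hM.2, map_sum, map_sum, Finset.smul_sum]
  have key : ∀ i ∈ Finset.range M, O.mkQ ((qchoose α i : ℂ) • V.mode v (i - β) u) =
      ∑ j ∈ Finset.range (M - i), ((qchoose α i : ℂ) * ((-1 : ℂ) ^ (((i + j : ℕ) : ℤ) - β + 1) *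
        (qchoose ((((i + j : ℕ) : ℤ) - β + 1 - a - b : ℤ) : ℚ) j : ℂ))) •
        O.mkQ (V.mode u (((i + j : ℕ) : ℤ) - β) v) := by
    intro i hi
    rw [Finset.mem_range] at hi
    rw [map_smul, mkQ_mode_swap V O hO hu hv hN _ (M - i) (by omega), Finset.smul_sum]
    refine Finset.sum_congr rfl fun j _ => ?_
    rw [smul_smul, show (i : ℤ) - β + j = ((i + j : ℕ) : ℤ) - β by push_cast; ring]
  rw [Finset.sum_congr rfl key, ← Finset.sum_range_diag_flip M fun i j =>
    ((qchoose α i : ℂ) * ((-1 : ℂ) ^ (((i + j : ℕ) : ℤ) - β + 1) *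
      (qchoose ((((i + j : ℕ) : ℤ) - β + 1 - a - b : ℤ) : ℚ) j : ℂ))) •
      O.mkQ (V.mode u (((i + j : ℕ) : ℤ) - β) v)]
  refine Finset.sum_congr rfl fun p _ => ?_
  have inner : ∀ i ∈ Finset.range (p + 1),
      ((qchoose α i : ℂ) * ((-1 : ℂ) ^ (((i + (p - i) : ℕ) : ℤ) - β + 1) *
        (qchoose ((((i + (p - i) : ℕ) : ℤ) - β + 1 - a - b : ℤ) : ℚ) (p - i) : ℂ))) •
        O.mkQ (V.mode u (((i + (p - i) : ℕ) : ℤ) - β) v) =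
      ((-1 : ℂ) ^ ((p : ℤ) - β + 1) * ((qchoose α i *
        qchoose (((p : ℤ) - β + 1 - a - b : ℤ) : ℚ) (p - i) : ℚ) : ℂ)) •
        O.mkQ (V.mode u ((p : ℤ) - β) v) := by
    intro i hi
    rw [Finset.mem_range] at hi
    rw [show i + (p - i) = p by omega, Rat.cast_mul]
    congr 1
    ring
  rw [Finset.sum_congr rfl inner, ← Finset.sum_smul, ← Finset.mul_sum, ← Rat.cast_sum,
    sum_qchoose_mul_qchoose, map_smul, smul_smul]
  congr 1
  rw [← neg_one_pow_mul_qchoose (a + b - α + β - 2) p]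
  have h1 : (-1 : ℂ) ≠ 0 := by norm_num
  have h2 : (-1 : ℂ) ^ ((p : ℤ) - β + 1) = (-1) ^ (β + 1) * (-1) ^ p := by
    rw [show (p : ℤ) - β + 1 = (β + 1) + p + (-β + -β) by ring, zpow_add₀ h1 _ (-β + -β),
      zpow_add₀ h1 _ (p : ℤ), zpow_add₀ h1 (-β), ← mul_zpow, zpow_natCast]
    simp
  rw [h2]
  push_cast
  rw [mul_assoc]
  congr 4
  ring

end Quotient

/-- **Lemma 2.2 (ii).** For homogeneous `u, v ∈ V^0` (of weights `a`, `b`),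
`u *_{g,n} v - v *_{g,n} u - Res_z Y(u,z)v (1+z)^{wt u - 1}` lies in `O_{g,n}(V)`
(`n = l + i/T`). -/
theorem star_comm_mem_Ogn (V : VOA) (g : VOAAut V) (T : ℕ) (hT : 0 < T)
    (hg : g.lin ^ T = 1) (l i : ℕ) (hi : i ≤ T - 1) :
    ∀ (a b : ℤ) (u v : V.carrier),
      u ∈ V.wtSpace a → u ∈ eigSpace V g T 0 →
      v ∈ V.wtSpace b → v ∈ eigSpace V g T 0 →
      starFor V l a u v - starFor V l b v u - V.res ((a : ℚ) - 1) 0 u v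
        ∈ Ogn V g T l i := by
  intro a b u v hu _ hv _
  have hO : ∀ x, V.mode V.conformal 0 x + V.mode V.conformal 1 x ∈ Ogn V g T l i :=
    fun x => Submodule.subset_span (Or.inl ⟨x, rfl⟩)
  rw [← Submodule.Quotient.mk_eq_zero, ← Submodule.mkQ_apply, map_sub, sub_eq_zero,
    ← V.sum_res_sub_res l, starFor, starFor, map_sub, map_sum, map_sum, map_sum,
    ← Finset.sum_sub_distrib]
  refine Finset.sum_congr rfl fun m _ => ?_
  rw [map_sub, map_smul, map_smul, map_smul, map_smul, mkQ_res_swap V _ hO hu hv, smul_smul]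
  have h : (-1 : ℂ) ^ m * ((m + l).choose l : ℂ) * (-1 : ℂ) ^ ((l : ℤ) + m + 1 + 1) =
      (-1) ^ l * ((m + l).choose l : ℂ) := by
    have hm : (-1 : ℂ) ^ m * (-1 : ℂ) ^ m = 1 := by rw [← mul_pow]; simp
    rw [show (l : ℤ) + m + 1 + 1 = ((l + m + 2 : ℕ) : ℤ) by push_cast; ring, zpow_natCast,
      pow_add, pow_add]
    linear_combination (-1) ^ l * ((m + l).choose l : ℂ) * hm
  rw [h]
  congr 4
  · ring
  · push_cast
    ring

end DLM
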